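/- For all real g and Δ, the hidden symmetry operator for bias ℓ = 1 satisfies the quadratic relation J₁ ∘ J₁ = 4g²·H₁ + (4g⁴ + 2g² + Δ²)·id on ℝ[z] ⊕ ℝ[z]; that is, J₁² = p₁(H₁; g, Δ) with p₁(x; g, Δ) = 4g²x + 4g⁴ + 2g² + Δ². -/

import Mathlib

open Polynomial

/-- The parity operator `(𝒫 f)(z) = f(-z)` on real polynomials. -/
noncomputable def Par (f : Polynomial ℝ) : Polynomial ℝ := f.comp (-Polynomial.X)

/-- Bargmann realization of `H̃₁ = a†a + Δσₓ + g(a+a†)σ_z + (1/2)σ_z`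
on `ℝ[z] ⊕ ℝ[z]`. -/
noncomputable def H1 (g Δ : ℝ) (F : Polynomial ℝ × Polynomial ℝ) :
    Polynomial ℝ × Polynomial ℝ :=
  (Polynomial.X * derivative F.1 + C g * (Polynomial.X * F.1 + derivative F.1)
      + C (1 / 2) * F.1 + C Δ * F.2,
   C Δ * F.1 + Polynomial.X * derivative F.2 - C g * (Polynomial.X * F.2 + derivative F.2)
      - C (1 / 2) * F.2)

/-- The hidden symmetry operator `J₁ = 𝒫 [[Δ, 2g(g−∂)],[2g(g+z), Δ]]`
on `ℝ[z] ⊕ ℝ[z]`. -/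
noncomputable def J1 (g Δ : ℝ) (F : Polynomial ℝ × Polynomial ℝ) :
    Polynomial ℝ × Polynomial ℝ :=
  (Par (C Δ * F.1 + C (2 * g) * (C g * F.2 - derivative F.2)),
   Par (C (2 * g) * ((C g + Polynomial.X) * F.1) + C Δ * F.2))

theorem Par_Par (f : ℝ[X]) : Par (Par f) = f := by
  simp [Par, comp_assoc]

theorem derivative_Par (f : ℝ[X]) : derivative (Par f) = -Par (derivative f) := by
  simp [Par, derivative_comp]

theorem Par_add (f g : ℝ[X]) : Par (f + g) = Par f + Par g := add_comp

theorem Par_sub (f g : ℝ[X]) : Par (f - g) = Par f - Par g := sub_comp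

theorem Par_neg (f : ℝ[X]) : Par (-f) = -Par f := neg_comp

theorem Par_mul (f g : ℝ[X]) : Par (f * g) = Par f * Par g := mul_comp _ _ _

theorem Par_C (a : ℝ) : Par (C a) = C a := C_comp

theorem Par_ofNat (n : ℕ) [n.AtLeastTwo] :
    Par (ofNat(n) : ℝ[X]) = ofNat(n) := ofNat_comp n

theorem Par_zero : Par 0 = 0 := zero_comp

theorem Par_one : Par 1 = 1 := one_comp

theorem Par_X : Par X = -X := X_comp

/-- Quadratic relation `J₁² = p₁(H₁; g, Δ)` with
`p₁(x; g, Δ) = 4g²x + 4g⁴ + 2g² + Δ²`. -/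
theorem stmt5 (g Δ : ℝ) :
    J1 g Δ ∘ J1 g Δ
      = fun F => (4 * g ^ 2) • H1 g Δ F + (4 * g ^ 4 + 2 * g ^ 2 + Δ ^ 2) • F := by
  have half : (2 : ℝ[X]) * C (1 / 2) = 1 := by
    rw [← C_ofNat, ← C_mul]
    norm_num
  funext ⟨p, q⟩
  ext1
  · simp only [Function.comp_apply, J1, H1, Prod.fst_add, Prod.smul_fst, smul_eq_C_mul,
      Par_add, Par_sub, Par_neg, Par_mul, Par_C, Par_X, Par_Par, derivative_Par,
      derivative_add, derivative_mul, derivative_C, derivative_neg, derivative_ofNat,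
      derivative_X, Par_ofNat, Par_zero, Par_one, C_add, C_mul, C_pow, C_ofNat]
    linear_combination -2 * C g ^ 2 * p * half
  · simp only [Function.comp_apply, J1, H1, Prod.snd_add, Prod.smul_snd, smul_eq_C_mul,
      Par_add, Par_sub, Par_neg, Par_mul, Par_C, Par_X, Par_Par, derivative_Par,
      derivative_add, derivative_mul, derivative_C, derivative_neg, derivative_ofNat,
      derivative_X, Par_ofNat, Par_zero, Par_one, C_add, C_mul, C_pow, C_ofNat]
    linear_combination 2 * C g ^ 2 * q * half
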